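/- Let G be a discrete group and L a length function on G with bounded doubling, say |B(2r)| ≤ C_L·|B(r)| for all r ≥ 1, and fix R = 2^K for an integer K ≥ 2. Then there is a constant C < ∞, depending only on C_L and R (and independent of N), such that for every finitely supported f : G → ℂ and every integer N ≥ 1, J_D(p_N^f) ≤ C · J_D(f), where p_N^f = Σ_{n≥N} g_{2n}·f. -/

import Mathlib

open scoped ENNReal ComplexConjugate

noncomputable section

variable {G : Type*}

/-- The Hilbert space `ℓ²(G)` of square-summable complex-valued functions on `G`. -/
abbrev l2 (G : Type*) : Type _ := lp (fun _ : G => ℂ) 2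

variable [Group G]

/-- A length function on a group `G`: subadditive, symmetric under inverses,
and vanishing exactly at the identity. -/
structure IsLengthFunction (L : G → ℝ) : Prop where
  nonneg : ∀ x, 0 ≤ L x
  subadd : ∀ x y, L (x * y) ≤ L x + L y
  inv_eq : ∀ x, L x⁻¹ = L x
  eq_zero_iff : ∀ x, L x = 0 ↔ x = 1

/-- The ball `B(r) = {x ∈ G : L x ≤ r}`. -/
def lball (L : G → ℝ) (r : ℝ) : Set G := {x : G | L x ≤ r}

/-- A length function is proper if all balls are finite. -/
def IsProperLF (L : G → ℝ) : Prop := ∀ r : ℝ, (lball L r).Finite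

/-- Bounded doubling: `L` is proper and there is `C < ∞` with
`|B(2r)| ≤ C |B(r)|` for all `r ≥ 1`. -/
def HasBoundedDoubling (L : G → ℝ) : Prop :=
  IsProperLF L ∧ ∃ C : ℝ, ∀ r : ℝ, 1 ≤ r →
    ((lball L (2 * r)).ncard : ℝ) ≤ C * ((lball L r).ncard : ℝ)

/-- `T` is the convolution operator `λ_f`, `(λ_f ξ)(x) = Σ_y f(xy⁻¹) ξ(y)`. -/
def IsConvOp (f : G → ℂ) (T : l2 G →L[ℂ] l2 G) : Prop :=
  ∀ (ξ : l2 G) (x : G), T ξ x = ∑' y : G, f (x * y⁻¹) * ξ y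

/-- `T` is the commutator `[D, λ_f]` for `D = M_L`, i.e.
`([D,λ_f] ξ)(x) = Σ_y (L x − L y) f(xy⁻¹) ξ(y)`. -/
def IsCommOp (L : G → ℝ) (f : G → ℂ) (T : l2 G →L[ℂ] l2 G) : Prop :=
  ∀ (ξ : l2 G) (x : G), T ξ x = ∑' y : G, ((L x : ℂ) - (L y : ℂ)) * f (x * y⁻¹) * ξ y

/-- `T` is the truncated operator `(I − M_{2r}) λ_f M_r`. -/
def IsTruncOp (L : G → ℝ) (f : G → ℂ) (r : ℝ) (T : l2 G →L[ℂ] l2 G) : Prop :=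
  ∀ (ξ : l2 G) (x : G),
    T ξ x = if L x ≤ 2 * r then 0
      else ∑' y : G, (if L y ≤ r then f (x * y⁻¹) * ξ y else 0)

/-- The seminorm `J_D(f) = sup_{r>0} r ‖(I − M_{2r}) λ_f M_r‖`. -/
def JD (L : G → ℝ) (f : G → ℂ) : ℝ :=
  sSup {a : ℝ | ∃ r : ℝ, 0 < r ∧ ∃ T : l2 G →L[ℂ] l2 G, IsTruncOp L f r T ∧ a = r * ‖T‖}

/-- The convolution `h* ∗ k`, where `h*(z) = conj (h z⁻¹)`. -/
def starConv (h k : G → ℂ) : G → ℂ :=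
  fun x => ∑' z : G, conj (h z⁻¹) * k (z⁻¹ * x)

/-- The `ℓ²` norm `‖h‖₂ = (Σ_x |h x|²)^{1/2}` of a function `h : G → ℂ`. -/
def l2norm (h : G → ℂ) : ℝ := Real.sqrt (∑' x : G, ‖h x‖ ^ 2)

/-- The complex-valued cutoff function `g_n = h_n* ∗ k_n`, where
`k_n = |B(R^{n-1})|⁻¹ χ_{B(R^{n-1})}` and `h_n = χ_{A(R^n, R^{n+1})}`. -/
def gCut (L : G → ℝ) (R : ℝ) (n : ℕ) : G → ℂ :=
  fun x => ∑' z : G,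
    (if R ^ n < L z⁻¹ ∧ L z⁻¹ ≤ R ^ (n + 1) then (1 : ℂ) else 0) *
      (((lball L (R ^ (n - 1))).ncard : ℂ)⁻¹ *
        if L (z⁻¹ * x) ≤ R ^ (n - 1) then 1 else 0)

/-- The integral kernel of the truncated operator `(I − M_{2r}) λ_f M_r`. -/
def truncKer (L : G → ℝ) (f : G → ℂ) (r : ℝ) (x y : G) : ℂ :=
  if 2 * r < L x ∧ L y ≤ r then f (x * y⁻¹) else 0

/-- The bilinear form with kernel `F` is bounded by `c` on finitely supported vectors
of `ℓ²`. -/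
def KernelBound {X : Type*} (F : X → X → ℂ) (c : ℝ) : Prop :=
  ∀ (S T : Finset X) (u v : X → ℂ),
    ‖∑ x ∈ S, ∑ y ∈ T, u x * F x y * v y‖ ≤
      c * (√(∑ x ∈ S, ‖u x‖ ^ 2) * √(∑ y ∈ T, ‖v y‖ ^ 2))

namespace KernelBound

variable {X : Type*}

theorem mono {F : X → X → ℂ} {c d : ℝ} (h : KernelBound F c) (hcd : c ≤ d) :
    KernelBound F d := fun S T u v =>
  (h S T u v).trans (mul_le_mul_of_nonneg_right hcd (by positivity))

theorem sum {ι : Type*} (I : Finset ι) {F : ι → X → X → ℂ} {c : ι → ℝ}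
    (h : ∀ i ∈ I, KernelBound (F i) (c i)) :
    KernelBound (fun x y => ∑ i ∈ I, F i x y) (∑ i ∈ I, c i) := by
  intro S T u v
  have hswap : ∑ x ∈ S, ∑ y ∈ T, u x * (∑ i ∈ I, F i x y) * v y =
      ∑ i ∈ I, ∑ x ∈ S, ∑ y ∈ T, u x * F i x y * v y := by
    simp only [Finset.mul_sum, Finset.sum_mul]
    rw [Finset.sum_comm (s := I)]
    refine Finset.sum_congr rfl fun x _ => ?_
    rw [Finset.sum_comm]
  rw [hswap, Finset.sum_mul]
  exact norm_sum_le_of_le _ fun i hi => h i hi S T u v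

theorem restrict {F : X → X → ℂ} {c : ℝ} (hc : 0 ≤ c) (h : KernelBound F c)
    {a b : X → ℂ} (ha : ∀ x, ‖a x‖ ≤ 1) (hb : ∀ y, ‖b y‖ ≤ 1) :
    KernelBound (fun x y => a x * F x y * b y) c := by
  intro S T u v
  calc ‖∑ x ∈ S, ∑ y ∈ T, u x * (a x * F x y * b y) * v y‖
      = ‖∑ x ∈ S, ∑ y ∈ T, (u x * a x) * F x y * (b y * v y)‖ := by
        simp only [mul_assoc]
    _ ≤ _ := h S T (fun x => u x * a x) (fun y => b y * v y)
    _ ≤ _ := by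
        gcongr with x _ y _
        · rw [norm_mul]
          exact mul_le_of_le_one_right (norm_nonneg _) (ha x)
        · rw [norm_mul]
          exact mul_le_of_le_one_left (norm_nonneg _) (hb y)

theorem comp_equiv {Y : Type*} {F : X → X → ℂ} {c : ℝ} (h : KernelBound F c) (e : Y ≃ X) :
    KernelBound (fun x y => F (e x) (e y)) c := by
  intro S T u v
  have := h (S.map e.toEmbedding) (T.map e.toEmbedding) (u ∘ e.symm) (v ∘ e.symm)
  simpa [Finset.sum_map] using this

/-- A kernel supported in a finite rectangle is bounded by the sum of its absolute values. -/
theorem of_finite_support {F : X → X → ℂ} (P Q : Finset X)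
    (hF : ∀ x y, F x y ≠ 0 → x ∈ P ∧ y ∈ Q) :
    KernelBound F (∑ x ∈ P, ∑ y ∈ Q, ‖F x y‖) := by
  classical
  intro S T u v
  set U := √(∑ x ∈ S, ‖u x‖ ^ 2)
  set V := √(∑ y ∈ T, ‖v y‖ ^ 2)
  have hu : ∀ x ∈ S, ‖u x‖ ≤ U := fun x hx => Real.le_sqrt_of_sq_le
    (Finset.single_le_sum (f := fun x => ‖u x‖ ^ 2) (fun _ _ => by positivity) hx)
  have hv : ∀ y ∈ T, ‖v y‖ ≤ V := fun y hy => Real.le_sqrt_of_sq_le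
    (Finset.single_le_sum (f := fun y => ‖v y‖ ^ 2) (fun _ _ => by positivity) hy)
  have hU0 : 0 ≤ U := Real.sqrt_nonneg _
  have hV0 : 0 ≤ V := Real.sqrt_nonneg _
  have key : ∀ x ∈ S, ∑ y ∈ T, ‖F x y‖ ≤ ∑ y ∈ Q, ‖F x y‖ := by
    intro x _
    rw [← Finset.sum_filter_ne_zero]
    refine Finset.sum_le_sum_of_subset_of_nonneg (fun y hy => ?_) fun _ _ _ => norm_nonneg _
    simp only [Finset.mem_filter, ne_eq, norm_eq_zero] at hy
    exact (hF x y hy.2).2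
  have key' : ∑ x ∈ S, ∑ y ∈ Q, ‖F x y‖ ≤ ∑ x ∈ P, ∑ y ∈ Q, ‖F x y‖ := by
    rw [← Finset.sum_filter_ne_zero]
    refine Finset.sum_le_sum_of_subset_of_nonneg (fun x hx => ?_)
      fun _ _ _ => Finset.sum_nonneg fun _ _ => norm_nonneg _
    obtain ⟨y, -, hy⟩ := Finset.exists_ne_zero_of_sum_ne_zero (Finset.mem_filter.1 hx).2
    exact (hF x y (by simpa using hy)).1
  calc ‖∑ x ∈ S, ∑ y ∈ T, u x * F x y * v y‖
      ≤ ∑ x ∈ S, ∑ y ∈ T, ‖F x y‖ * (U * V) := by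
        refine norm_sum_le_of_le _ fun x hx => norm_sum_le_of_le _ fun y hy => ?_
        rw [norm_mul, norm_mul]
        calc ‖u x‖ * ‖F x y‖ * ‖v y‖ ≤ U * ‖F x y‖ * V := by
              gcongr
              · exact hu x hx
              · exact hv y hy
          _ = _ := by ring
    _ = (∑ x ∈ S, ∑ y ∈ T, ‖F x y‖) * (U * V) := by simp only [Finset.sum_mul]
    _ ≤ _ := mul_le_mul_of_nonneg_right ((Finset.sum_le_sum key).trans key') (by positivity)

end KernelBound

theorem l2_sqrt_sum_sq_le {X : Type*} (ξ : l2 X) (S : Finset X) : √(∑ x ∈ S, ‖ξ x‖ ^ 2) ≤ ‖ξ‖ := by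
  refine Real.sqrt_le_iff.2 ⟨norm_nonneg _, ?_⟩
  have := lp.sum_rpow_le_norm_rpow (p := 2) (by norm_num) ξ S
  simpa using this

theorem l2_norm_sum_single {X : Type*} [DecidableEq X] (v : X → ℂ) (T : Finset X) :
    ‖∑ y ∈ T, (lp.single 2 y (v y) : l2 X)‖ = √(∑ y ∈ T, ‖v y‖ ^ 2) := by
  have := lp.norm_sum_single (p := 2) (E := fun _ : X => ℂ) (by norm_num) v T
  simp only [ENNReal.toReal_ofNat, Real.rpow_ofNat] at this
  rw [← this, Real.sqrt_sq (norm_nonneg _)]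

theorem IsTruncOp.apply_eq_sum {L : G → ℝ} {f : G → ℂ} {r : ℝ} {T : l2 G →L[ℂ] l2 G}
    (h : IsTruncOp L f r T) (ξ : l2 G) (Q : Finset G)
    (hQ : ∀ y, L y ≤ r → ξ y ≠ 0 → y ∈ Q) (x : G) :
    T ξ x = ∑ y ∈ Q, truncKer L f r x y * ξ y := by
  rw [h ξ x]
  split_ifs with hx
  · refine (Finset.sum_eq_zero fun y _ => ?_).symm
    simp [truncKer, not_lt.2 hx]
  · rw [tsum_eq_sum (s := Q)]
    · refine Finset.sum_congr rfl fun y _ => ?_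
      simp [truncKer, not_le.1 hx]
    · intro y hy
      split_ifs with hyr
      · by_cases h0 : ξ y = 0
        · simp [h0]
        · exact absurd (hQ y hyr h0) hy
      · rfl

theorem IsTruncOp.kernelBound {L : G → ℝ} {f : G → ℂ} {r : ℝ} {T : l2 G →L[ℂ] l2 G}
    (h : IsTruncOp L f r T) : KernelBound (truncKer L f r) ‖T‖ := by
  classical
  intro P Q u v
  set ξ : l2 G := ∑ y ∈ Q, (lp.single 2 y (v y) : l2 G) with hξ
  have hξ_apply : ∀ y, ξ y = if y ∈ Q then v y else 0 := fun y => by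
    simp only [hξ, lp.coeFn_single, lp.coeFn_sum, Finset.sum_apply, Finset.sum_pi_single]
  have hT : ∀ x, T ξ x = ∑ y ∈ Q, truncKer L f r x y * v y := fun x => by
    rw [h.apply_eq_sum ξ Q (fun y _ hy => by
      by_contra hyQ
      exact hy (by rw [hξ_apply, if_neg hyQ]))]
    exact Finset.sum_congr rfl fun y hy => by rw [hξ_apply, if_pos hy]
  calc ‖∑ x ∈ P, ∑ y ∈ Q, u x * truncKer L f r x y * v y‖
      = ‖∑ x ∈ P, u x * T ξ x‖ := by
        simp only [hT, Finset.mul_sum, mul_assoc]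
    _ ≤ ∑ x ∈ P, ‖u x‖ * ‖T ξ x‖ := norm_sum_le_of_le _ fun x _ => (norm_mul _ _).le
    _ ≤ √(∑ x ∈ P, ‖u x‖ ^ 2) * √(∑ x ∈ P, ‖T ξ x‖ ^ 2) :=
        Real.sum_mul_le_sqrt_mul_sqrt _ _ _
    _ ≤ √(∑ x ∈ P, ‖u x‖ ^ 2) * (‖T‖ * √(∑ y ∈ Q, ‖v y‖ ^ 2)) := by
        gcongr
        rw [← l2_norm_sum_single v Q]
        exact (l2_sqrt_sum_sq_le _ _).trans (T.le_opNorm ξ)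
    _ = _ := by ring

theorem IsTruncOp.norm_le {L : G → ℝ} (hL : IsProperLF L) {f : G → ℂ} {r c : ℝ} (hc : 0 ≤ c)
    {T : l2 G →L[ℂ] l2 G} (h : IsTruncOp L f r T) (hF : KernelBound (truncKer L f r) c) :
    ‖T‖ ≤ c := by
  refine T.opNorm_le_bound hc fun ξ => ?_
  refine lp.norm_le_of_forall_sum_le (p := 2) (by norm_num) (by positivity) fun P => ?_
  simp only [ENNReal.toReal_ofNat, Real.rpow_ofNat]
  set Q := (hL r).toFinset
  have hT := h.apply_eq_sum ξ Q (fun y hy _ => (hL r).mem_toFinset.2 hy)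
  set a := √(∑ x ∈ P, ‖T ξ x‖ ^ 2)
  have ha2 : ∑ x ∈ P, ‖T ξ x‖ ^ 2 = a ^ 2 := (Real.sq_sqrt (by positivity)).symm
  have ha0 : 0 ≤ a := Real.sqrt_nonneg _
  have h1 : a ^ 2 ≤ c * (a * ‖ξ‖) := by
    calc a ^ 2 = ‖((a ^ 2 : ℝ) : ℂ)‖ := by simp
      _ = ‖∑ x ∈ P, ∑ y ∈ Q, conj (T ξ x) * truncKer L f r x y * ξ y‖ := by
          rw [← ha2]
          push_cast
          congr 1
          refine Finset.sum_congr rfl fun x _ => ?_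
          rw [← Complex.conj_mul']
          calc conj (T ξ x) * T ξ x
              = conj (T ξ x) * ∑ y ∈ Q, truncKer L f r x y * ξ y := congrArg _ (hT x)
            _ = _ := by simp only [Finset.mul_sum, mul_assoc]
      _ ≤ c * (√(∑ x ∈ P, ‖conj (T ξ x)‖ ^ 2) * √(∑ y ∈ Q, ‖ξ y‖ ^ 2)) := hF P Q _ _
      _ ≤ c * (a * ‖ξ‖) := by
          simp only [RCLike.norm_conj]
          gcongr
          exact l2_sqrt_sum_sq_le _ _
  rw [ha2]
  refine pow_le_pow_left₀ ha0 ?_ 2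
  rcases ha0.eq_or_lt with h0 | h0
  · rw [← h0]; positivity
  · nlinarith

theorem truncKer_eq_zero {L : G → ℝ} (hL : IsLengthFunction L) {f : G → ℂ} {r : ℝ}
    {x y : G} (h : ∀ s, r < L s → f s = 0) : truncKer L f r x y = 0 := by
  unfold truncKer
  split_ifs with hxy
  · refine h _ ?_
    have := hL.subadd (x * y⁻¹) y
    rw [inv_mul_cancel_right] at this
    linarith [hxy.1, hxy.2]
  · rfl

theorem exists_finset_truncKer {L : G → ℝ} (hL : IsProperLF L) (f : G →₀ ℂ) (r : ℝ) :
    ∃ P Q : Finset G, ∀ s ≤ r, ∀ x y, truncKer L f s x y ≠ 0 → x ∈ P ∧ y ∈ Q := by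
  classical
  refine ⟨(f.support ×ˢ (hL r).toFinset).image fun p => p.1 * p.2, (hL r).toFinset, ?_⟩
  intro s hs x y hxy
  unfold truncKer at hxy
  split_ifs at hxy with h
  · have hy : y ∈ (hL r).toFinset := (hL r).mem_toFinset.2 (h.2.trans hs)
    exact ⟨Finset.mem_image.2 ⟨(x * y⁻¹, y),
      Finset.mem_product.2 ⟨Finsupp.mem_support_iff.2 hxy, hy⟩, by simp⟩, hy⟩
  · exact absurd rfl hxy

theorem exists_isTruncOp {L : G → ℝ} (hL : IsProperLF L) (f : G →₀ ℂ) (r : ℝ) :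
    ∃ T : l2 G →L[ℂ] l2 G, IsTruncOp L f r T := by
  classical
  obtain ⟨P, Q, hPQ⟩ := exists_finset_truncKer hL f r
  refine ⟨∑ x ∈ P, ∑ y ∈ Q, truncKer L f r x y •
    (lp.evalCLM ℂ (fun _ : G => ℂ) 2 y).smulRight (lp.single 2 x (1 : ℂ) : l2 G), ?_⟩
  intro ξ x
  have hL1 : ((∑ x ∈ P, ∑ y ∈ Q, truncKer L f r x y •
      (lp.evalCLM ℂ (fun _ : G => ℂ) 2 y).smulRight (lp.single 2 x (1 : ℂ) : l2 G)) ξ) x =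
      ∑ y ∈ Q, truncKer L f r x y * ξ y := by
    have h1 : ∀ x', (∑ y ∈ Q, (truncKer L f r x' y • (lp.evalCLM ℂ (fun _ : G => ℂ) 2 y).smulRight
        (lp.single 2 x' (1 : ℂ) : l2 G)) ξ) =
        (lp.single 2 x' (∑ y ∈ Q, truncKer L f r x' y * ξ y) : l2 G) := by
      intro x'
      have h2 : ∀ a : ℂ, (lp.single 2 x' a : l2 G) = a • (lp.single 2 x' (1 : ℂ) : l2 G) :=
        fun a => by rw [← lp.single_smul, smul_eq_mul, mul_one]
      refine Eq.trans ?_ (h2 _).symm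
      rw [Finset.sum_smul]
      refine Finset.sum_congr rfl fun y _ => ?_
      rw [mul_smul]
      rfl
    simp only [sum_apply, h1]
    simp only [lp.coeFn_single, lp.coeFn_sum, Finset.sum_apply, Finset.sum_pi_single]
    split_ifs with hx
    · rfl
    · refine (Finset.sum_eq_zero fun y _ => ?_).symm
      by_contra h0
      exact hx (hPQ r le_rfl x y (left_ne_zero_of_mul h0)).1
  rw [hL1]
  split_ifs with hx
  · refine Finset.sum_eq_zero fun y _ => ?_
    simp [truncKer, not_lt.2 hx]
  · rw [tsum_eq_sum (s := Q)]
    · refine Finset.sum_congr rfl fun y _ => ?_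
      simp [truncKer, not_le.1 hx]
    · intro y hy
      split_ifs with hyr
      · by_contra h0
        refine hy (hPQ r le_rfl x y ?_).2
        simpa [truncKer, not_le.1 hx, hyr] using left_ne_zero_of_mul h0
      · rfl

theorem exists_length_lt {X : Type*} (L : X → ℝ) (f : X →₀ ℂ) :
    ∃ M : ℕ, ∀ s, (M : ℝ) < L s → f s = 0 := by
  obtain ⟨b, hb⟩ := (f.support.finite_toSet.image L).bddAbove
  obtain ⟨M, hM⟩ := exists_nat_ge b
  refine ⟨M, fun s hs => ?_⟩
  by_contra h0
  exact absurd (hb ⟨s, by simpa using h0, rfl⟩) (not_le.2 (hM.trans_lt hs))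

theorem bddAbove_JD {L : G → ℝ} (hL : IsLengthFunction L) (hLp : IsProperLF L) (f : G →₀ ℂ) :
    BddAbove {a : ℝ | ∃ r : ℝ, 0 < r ∧ ∃ T : l2 G →L[ℂ] l2 G,
      IsTruncOp L (f : G → ℂ) r T ∧ a = r * ‖T‖} := by
  classical
  obtain ⟨M, hM⟩ := exists_length_lt L f
  obtain ⟨P, Q, hPQ⟩ := exists_finset_truncKer hLp f M
  set c := ∑ x ∈ P, ∑ y ∈ Q, ‖f (x * y⁻¹)‖
  have hc : 0 ≤ c := by positivity
  refine ⟨M * c, ?_⟩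
  rintro _ ⟨r, hr, T, hT, rfl⟩
  rcases le_or_gt r M with h | h
  · gcongr
    refine hT.norm_le hLp hc ((KernelBound.of_finite_support P Q (hPQ r h)).mono ?_)
    refine Finset.sum_le_sum fun x _ => Finset.sum_le_sum fun y _ => ?_
    unfold truncKer
    split_ifs <;> simp
  · have h0 : ‖T‖ ≤ 0 := hT.norm_le hLp le_rfl fun S T' u v => by
      simp [truncKer_eq_zero hL fun s hs => hM s (h.trans hs)]
    have : r * ‖T‖ ≤ 0 := mul_nonpos_of_nonneg_of_nonpos hr.le h0
    have : 0 ≤ M * c := by positivity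
    linarith

theorem JD_nonneg (L : G → ℝ) (f : G → ℂ) : 0 ≤ JD L f := by
  refine Real.sSup_nonneg ?_
  rintro _ ⟨r, hr, T, -, rfl⟩
  positivity

theorem kernelBound_truncKer_JD {L : G → ℝ} (hL : IsLengthFunction L) (hLp : IsProperLF L)
    (f : G →₀ ℂ) {r : ℝ} (hr : 0 < r) : KernelBound (truncKer L f r) (JD L f / r) := by
  obtain ⟨T, hT⟩ := exists_isTruncOp hLp f r
  refine hT.kernelBound.mono ?_
  rw [le_div_iff₀ hr, mul_comm]
  exact le_csSup (bddAbove_JD hL hLp f) ⟨r, hr, T, hT, rfl⟩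

theorem sum_ite_length_mul_le {L : G → ℝ} (hL : IsProperLF L) (r : ℝ) (x : G)
    (W : Finset G) :
    ∑ w ∈ W, (if L (x * w) ≤ r then (1 : ℝ) else 0) ≤ (lball L r).ncard := by
  classical
  rw [Finset.sum_boole, Set.ncard_eq_toFinset_card _ (hL r)]
  norm_cast
  refine Finset.card_le_card_of_injOn (x * ·) (fun w hw => ?_) (mul_right_injective x).injOn
  simpa [lball] using (Finset.mem_filter.1 hw).2

theorem lball_ncard_pos {L : G → ℝ} (hL : IsLengthFunction L) (hLp : IsProperLF L) {r : ℝ}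
    (hr : 0 ≤ r) : 0 < (lball L r).ncard :=
  (Set.ncard_pos (hLp r)).2 ⟨1, by simpa [lball, (hL.eq_zero_iff 1).2 rfl] using hr⟩

theorem gCut_mul_inv {L : G → ℝ} (hL : IsLengthFunction L) (R : ℝ) (n : ℕ) (x y : G) :
    gCut L R n (x * y⁻¹) = ∑' w : G,
      (if R ^ n < L (x * w) ∧ L (x * w) ≤ R ^ (n + 1) then (1 : ℂ) else 0) *
      (((lball L (R ^ (n - 1))).ncard : ℂ)⁻¹ *
        if L (y * w) ≤ R ^ (n - 1) then 1 else 0) := by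
  unfold gCut
  rw [← (Equiv.mulLeft x).tsum_eq]
  refine tsum_congr fun w => ?_
  have h : (x * w)⁻¹ * (x * y⁻¹) = (y * w)⁻¹ := by group
  simp only [Equiv.coe_mulLeft, h, hL.inv_eq]

theorem kernelBound_gCut {L : G → ℝ} (hL : IsLengthFunction L) (hLp : IsProperLF L)
    (f : G → ℂ) {R : ℝ} (hR : 0 ≤ R) {n : ℕ} (hRn : 2 * R ^ (n - 1) ≤ R ^ n) {c D : ℝ}
    (hc : 0 ≤ c) (hf : KernelBound (truncKer L f (R ^ (n - 1))) c)
    (hD : ((lball L (R ^ (n + 1))).ncard : ℝ) ≤ D * (lball L (R ^ (n - 1))).ncard) :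
    KernelBound (fun x y => gCut L R n (x * y⁻¹) * f (x * y⁻¹)) (c * √D) := by
  classical
  intro S T u v
  set b := R ^ (n - 1)
  have hβ : 0 < ((lball L b).ncard : ℝ) := by
    exact_mod_cast lball_ncard_pos hL hLp (by positivity)
  set β : ℝ := ((lball L b).ncard : ℝ) with hβ_def
  set α : G → G → ℂ := fun x w =>
    if R ^ n < L (x * w) ∧ L (x * w) ≤ R ^ (n + 1) then 1 else 0 with hα
  set κ : G → G → ℂ := fun y w => if L (y * w) ≤ b then 1 else 0 with hκ
  set W : Finset G := T.biUnion fun y => (hLp b).toFinset.image (y⁻¹ * ·)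
  have hg : ∀ x, ∀ y ∈ T, gCut L R n (x * y⁻¹) =
      ∑ w ∈ W, α x w * ((β : ℂ)⁻¹ * κ y w) := by
    intro x y hy
    rw [gCut_mul_inv hL, tsum_eq_sum (s := W)]
    · simp [hα, hκ, hβ_def, b]
    · intro w hw
      have : ¬ L (y * w) ≤ b := fun h => hw <| Finset.mem_biUnion.2
        ⟨y, hy, Finset.mem_image.2 ⟨y * w, (hLp b).mem_toFinset.2 h, by simp⟩⟩
      simp [b] at this
      simp [not_le.2 this]
  have hsum : ∑ x ∈ S, ∑ y ∈ T, u x * (gCut L R n (x * y⁻¹) * f (x * y⁻¹)) * v y =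
      (β : ℂ)⁻¹ * ∑ w ∈ W, ∑ x ∈ S, ∑ y ∈ T,
        (u x * α x w) * truncKer L f b (x * w) (y * w) * (κ y w * v y) := by
    rw [Finset.sum_comm' (s := W) (t := fun _ => S) (t' := S) (s' := fun _ => W) (by tauto),
      Finset.mul_sum]
    refine Finset.sum_congr rfl fun x _ => ?_
    rw [Finset.sum_comm, Finset.mul_sum]
    refine Finset.sum_congr rfl fun y hy => ?_
    rw [hg x y hy, Finset.sum_mul, Finset.mul_sum, Finset.sum_mul, Finset.mul_sum]
    refine Finset.sum_congr rfl fun w _ => ?_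
    have hxy : x * w * (y * w)⁻¹ = x * y⁻¹ := by group
    simp only [hα, hκ, truncKer, hxy]
    by_cases h1 : R ^ n < L (x * w) ∧ L (x * w) ≤ R ^ (n + 1)
    · by_cases h2 : L (y * w) ≤ b
      · have h3 : 2 * b < L (x * w) := by linarith [h1.1]
        simp only [h1, h2, h3, and_self, if_true]
        ring
      · simp [h2]
    · simp [h1]
  rw [hsum, norm_mul]
  set U := ∑ x ∈ S, ‖u x‖ ^ 2
  set V := ∑ y ∈ T, ‖v y‖ ^ 2
  set A := ((lball L (R ^ (n + 1))).ncard : ℝ)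
  have hα2 : ∑ w ∈ W, ∑ x ∈ S, ‖u x * α x w‖ ^ 2 ≤ A * U := by
    rw [Finset.sum_comm, Finset.mul_sum]
    refine Finset.sum_le_sum fun x _ => ?_
    calc ∑ w ∈ W, ‖u x * α x w‖ ^ 2
        ≤ ∑ w ∈ W, (if L (x * w) ≤ R ^ (n + 1) then (1 : ℝ) else 0) * ‖u x‖ ^ 2 := by
          refine Finset.sum_le_sum fun w _ => ?_
          simp only [hα]
          split_ifs with h1 h2 h2
          · simp
          · exact absurd h1.2 h2
          · simp
          · simp
      _ ≤ _ := by
          rw [← Finset.sum_mul]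
          gcongr
          exact sum_ite_length_mul_le hLp _ _ _
  have hκ2 : ∑ w ∈ W, ∑ y ∈ T, ‖κ y w * v y‖ ^ 2 ≤ β * V := by
    rw [Finset.sum_comm, Finset.mul_sum]
    refine Finset.sum_le_sum fun y _ => ?_
    calc ∑ w ∈ W, ‖κ y w * v y‖ ^ 2
        = ∑ w ∈ W, (if L (y * w) ≤ b then (1 : ℝ) else 0) * ‖v y‖ ^ 2 := by
          refine Finset.sum_congr rfl fun w _ => ?_
          simp only [hκ]
          split_ifs <;> simp
      _ ≤ _ := by
          rw [← Finset.sum_mul]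
          gcongr
          exact sum_ite_length_mul_le hLp _ _ _
  calc ‖(β : ℂ)⁻¹‖ * ‖∑ w ∈ W, ∑ x ∈ S, ∑ y ∈ T,
        (u x * α x w) * truncKer L f b (x * w) (y * w) * (κ y w * v y)‖
      ≤ β⁻¹ * ∑ w ∈ W, c * (√(∑ x ∈ S, ‖u x * α x w‖ ^ 2) *
          √(∑ y ∈ T, ‖κ y w * v y‖ ^ 2)) := by
        have : ‖(β : ℂ)⁻¹‖ = β⁻¹ := by simp [abs_of_pos hβ]
        rw [this]
        gcongr
        exact norm_sum_le_of_le _ fun w _ => hf.comp_equiv (Equiv.mulRight w) S T _ _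
    _ ≤ β⁻¹ * (c * (√(∑ w ∈ W, ∑ x ∈ S, ‖u x * α x w‖ ^ 2) *
          √(∑ w ∈ W, ∑ y ∈ T, ‖κ y w * v y‖ ^ 2))) := by
        rw [← Finset.mul_sum]
        gcongr
        exact Real.sum_sqrt_mul_sqrt_le _ (fun _ => by positivity) fun _ => by positivity
    _ ≤ β⁻¹ * (c * (√(D * β * U) * √(β * V))) := by
        gcongr
        exact hα2.trans (by gcongr)
    _ = c * √D * (√U * √V) := by
        have hD0 : 0 ≤ D := by
          by_contra! h
          have : D * β < 0 := mul_neg_of_neg_of_pos h hβ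
          have : 0 ≤ A := by positivity
          linarith
        rw [Real.sqrt_mul (by positivity), Real.sqrt_mul hD0, Real.sqrt_mul hβ.le]
        calc β⁻¹ * (c * (√D * √β * √U * (√β * √V)))
            = β⁻¹ * (√β * √β) * (c * √D * (√U * √V)) := by ring
          _ = _ := by rw [Real.mul_self_sqrt hβ.le, inv_mul_cancel₀ hβ.ne', one_mul]

theorem exists_of_gCut_ne_zero {L : G → ℝ} {R : ℝ} {n : ℕ} {x : G} (h : gCut L R n x ≠ 0) :
    ∃ z, R ^ n < L z⁻¹ ∧ L z⁻¹ ≤ R ^ (n + 1) ∧ L (z⁻¹ * x) ≤ R ^ (n - 1) := by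
  by_contra! h0
  refine h ?_
  unfold gCut
  convert tsum_zero with z
  split_ifs with h1 h2 <;> try simp
  exact absurd h2 (not_le.2 (h0 z h1.1 h1.2))

theorem lt_length_of_gCut_ne_zero {L : G → ℝ} (hL : IsLengthFunction L) {R : ℝ} {n : ℕ} {x : G}
    (h : gCut L R n x ≠ 0) : R ^ n - R ^ (n - 1) < L x := by
  obtain ⟨z, h1, -, h3⟩ := exists_of_gCut_ne_zero h
  have := hL.subadd (z⁻¹ * x) x⁻¹
  rw [mul_inv_cancel_right, hL.inv_eq x] at this
  linarith

theorem length_le_of_gCut_ne_zero {L : G → ℝ} (hL : IsLengthFunction L) {R : ℝ} {n : ℕ} {x : G}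
    (h : gCut L R n x ≠ 0) : L x ≤ R ^ (n + 1) + R ^ (n - 1) := by
  obtain ⟨z, -, h2, h3⟩ := exists_of_gCut_ne_zero h
  have := hL.subadd z (z⁻¹ * x)
  rw [mul_inv_cancel_left, ← hL.inv_eq z] at this
  linarith

theorem lball_ncard_two_pow_mul_le {X : Type*} {L : X → ℝ} {C : ℝ} (hC : 0 ≤ C)
    (h : ∀ r : ℝ, 1 ≤ r → ((lball L (2 * r)).ncard : ℝ) ≤ C * (lball L r).ncard)
    (j : ℕ) {r : ℝ} (hr : 1 ≤ r) :
    ((lball L (2 ^ j * r)).ncard : ℝ) ≤ C ^ j * (lball L r).ncard := by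
  induction j with
  | zero => simp
  | succ j ih =>
    have h1 : 1 ≤ 2 ^ j * r := one_le_mul_of_one_le_of_one_le (one_le_pow₀ (by norm_num)) hr
    calc ((lball L (2 ^ (j + 1) * r)).ncard : ℝ)
        = (lball L (2 * (2 ^ j * r))).ncard := by rw [pow_succ']; ring_nf
      _ ≤ C * (C ^ j * (lball L r).ncard) := (h _ h1).trans (by gcongr)
      _ = _ := by ring

theorem sum_div_pow_le {R r : ℝ} (hR : 2 ≤ R) (I : Finset ℕ)
    (hI : ∀ n ∈ I, 1 ≤ n ∧ r < 2 * R ^ (2 * n + 1)) :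
    ∑ n ∈ I, r / R ^ (2 * n - 1) ≤ 4 * R ^ 2 := by
  rcases I.eq_empty_or_nonempty with rfl | hne
  · simp; positivity
  have hR0 : 0 < R := by linarith
  set m := I.min' hne
  have hm := hI m (I.min'_mem hne)
  have hterm : ∀ n ∈ I, r / R ^ (2 * n - 1) ≤ 2 * R ^ 2 * (1 / 2) ^ (n - m) := by
    intro n hn
    obtain ⟨j, hj⟩ : ∃ j, n = m + j := Nat.exists_eq_add_of_le (I.min'_le n hn)
    rw [hj]
    obtain ⟨k, hk⟩ := Nat.exists_eq_add_of_le hm.1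
    have e1 : 2 * (m + j) - 1 = 2 * k + 1 + 2 * j := by omega
    have e2 : 2 * m + 1 = 2 * k + 1 + 2 := by omega
    rw [e1, Nat.add_sub_cancel_left, div_le_iff₀ (by positivity), pow_add R _ (2 * j)]
    have h3 : (1 : ℝ) ≤ (1 / 2) ^ j * R ^ (2 * j) := by
      rw [pow_mul, ← mul_pow]
      exact one_le_pow₀ (by nlinarith)
    calc r ≤ 2 * R ^ (2 * m + 1) := hm.2.le
      _ = 2 * R ^ 2 * R ^ (2 * k + 1) * 1 := by rw [e2, pow_add R _ 2]; ring
      _ ≤ 2 * R ^ 2 * R ^ (2 * k + 1) * ((1 / 2) ^ j * R ^ (2 * j)) := by gcongr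
      _ = _ := by ring
  calc ∑ n ∈ I, r / R ^ (2 * n - 1) ≤ ∑ n ∈ I, 2 * R ^ 2 * (1 / 2) ^ (n - m) :=
        Finset.sum_le_sum hterm
    _ = 2 * R ^ 2 * ∑ j ∈ I.image (· - m), (1 / 2) ^ j := by
        rw [Finset.mul_sum, Finset.sum_image]
        intro a ha b hb hab
        have h1 := I.min'_le a ha
        have h2 := I.min'_le b hb
        simp only [m] at hab
        omega
    _ ≤ 2 * R ^ 2 * ∑ j ∈ Finset.range (I.sup (· - m) + 1), (1 / 2) ^ j := by
        gcongr
        intro j hj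
        obtain ⟨n, hn, rfl⟩ := Finset.mem_image.1 hj
        exact Finset.mem_range_succ_iff.2 (Finset.le_sup (f := (· - m)) hn)
    _ ≤ 2 * R ^ 2 * 2 := by
        gcongr
        exact sum_geometric_two_le _
    _ = _ := by ring

/-- there is `C < ∞`, depending only on the doubling constant `C_L`
and `R = 2^K` (`K ≥ 2`), independent of `N`, such that `J_D(p_N^f) ≤ C J_D(f)`
where `p_N^f = Σ_{n≥N} g_{2n}·f`, for every finitely supported `f` and `N ≥ 1`. -/
theorem exists_const_JD_pN_le :
    ∀ (CL : ℝ) (K : ℕ), 2 ≤ K →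
    ∃ C : ℝ, ∀ (G : Type*) [Group G] (L : G → ℝ),
      IsLengthFunction L → IsProperLF L →
      (∀ r : ℝ, 1 ≤ r →
        ((lball L (2 * r)).ncard : ℝ) ≤ CL * ((lball L r).ncard : ℝ)) →
      ∀ f : G →₀ ℂ, ∀ N : ℕ, 1 ≤ N →
        JD L (fun x =>
          (∑' n : ℕ, if N ≤ n then gCut L ((2 : ℝ) ^ K) (2 * n) x else 0) * f x) ≤
          C * JD L (f : G → ℂ) := by
  intro CL K hK
  set R : ℝ := 2 ^ K
  have hR : 4 ≤ R := by
    calc (4 : ℝ) = 2 ^ 2 := by norm_num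
      _ ≤ 2 ^ K := pow_le_pow_right₀ (by norm_num) hK
  refine ⟨√(CL ^ (2 * K)) * (4 * R ^ 2), ?_⟩
  intro G _ L hL hLp hdbl f N hN
  have hCL : 0 ≤ CL := by
    by_contra! h
    have h1 := hdbl 1 le_rfl
    have h2 : (0 : ℝ) < (lball L 1).ncard := by
      exact_mod_cast lball_ncard_pos hL hLp zero_le_one
    have h3 : CL * ((lball L 1).ncard : ℝ) < 0 := mul_neg_of_neg_of_pos h h2
    have h4 : (0 : ℝ) ≤ (lball L (2 * 1)).ncard := by positivity
    linarith
  set D := CL ^ (2 * K)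
  have hJ := JD_nonneg L f
  have hR1 : 1 ≤ R := by linarith
  have hstep : ∀ n : ℕ, 1 ≤ n → R ^ n = R * R ^ (n - 1) := fun n hn => by
    rw [← pow_succ', Nat.sub_add_cancel hn]
  have hg : ∀ n : ℕ, 1 ≤ n → KernelBound
      (fun x y => gCut L R n (x * y⁻¹) * f (x * y⁻¹)) (JD L f / R ^ (n - 1) * √D) := by
    intro n hn
    have hb : 1 ≤ R ^ (n - 1) := one_le_pow₀ hR1
    refine kernelBound_gCut hL hLp f (by linarith) ?_ (by positivity)
      (kernelBound_truncKer_JD hL hLp f (by positivity)) ?_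
    · rw [hstep n hn]
      gcongr
      linarith
    · have e : R ^ (n + 1) = 2 ^ (2 * K) * R ^ (n - 1) := by
        rw [pow_succ, hstep n hn, two_mul, pow_add]
        ring
      rw [e]
      exact lball_ncard_two_pow_mul_le hCL hdbl _ hb
  obtain ⟨M, hM⟩ := exists_length_lt L f
  refine Real.sSup_le ?_ (by positivity)
  rintro _ ⟨r, hr, T, hT, rfl⟩
  set I := (Finset.Icc N M).filter fun n => r < 2 * R ^ (2 * n + 1) with hI
  have hI1 : ∀ n ∈ I, 1 ≤ n ∧ r < 2 * R ^ (2 * n + 1) := fun n hn => by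
    simp only [hI, Finset.mem_filter, Finset.mem_Icc] at hn
    exact ⟨hN.trans hn.1.1, hn.2⟩
  have hker : KernelBound (truncKer L (fun x =>
      (∑' n : ℕ, if N ≤ n then gCut L R (2 * n) x else 0) * f x) r)
      (∑ n ∈ I, JD L f / R ^ (2 * n - 1) * √D) := by
    have hsum := KernelBound.sum I fun n hn => (hg (2 * n) (by have := (hI1 n hn).1; omega)).restrict
      (by positivity) (a := fun x => if 2 * r < L x then 1 else 0)
      (b := fun y => if L y ≤ r then 1 else 0) (fun x => by split_ifs <;> simp)
      (fun y => by split_ifs <;> simp)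
    convert hsum using 3 with x y
    unfold truncKer
    split_ifs with h1 h2 h3 h2 h3 <;> try simp
    · by_cases hf : f (x * y⁻¹) = 0
      · simp [hf]
      rw [← Finset.sum_mul]
      congr 1
      rw [tsum_eq_sum (s := I)]
      · refine Finset.sum_congr rfl fun n hn => if_pos ?_
        simp only [hI, Finset.mem_filter, Finset.mem_Icc] at hn
        exact hn.1.1
      · intro n hn
        split_ifs with hNn
        · by_contra h0
          refine hn ?_
          simp only [hI, Finset.mem_filter, Finset.mem_Icc]
          have hn1 : 1 ≤ 2 * n := by omega
          refine ⟨⟨hNn, ?_⟩, ?_⟩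
          · by_contra! hMn
            refine hf (hM _ ?_)
            refine lt_trans ?_ (lt_length_of_gCut_ne_zero hL h0)
            rw [hstep _ hn1]
            have h5 : (n : ℝ) < 2 ^ n := by exact_mod_cast Nat.lt_two_pow_self
            have h6 : (2 : ℝ) ^ n ≤ R ^ (2 * n - 1) :=
              (pow_le_pow_left₀ (by norm_num) (by linarith) n).trans
                (pow_le_pow_right₀ hR1 (by omega))
            have h7 : (M : ℝ) < n := by exact_mod_cast hMn
            have h8 : 0 < R ^ (2 * n - 1) := by positivity
            nlinarith
          · have h4 := length_le_of_gCut_ne_zero hL h0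
            have h5 := hL.subadd (x * y⁻¹) y
            rw [inv_mul_cancel_right] at h5
            have h6 : R ^ (2 * n - 1) ≤ R ^ (2 * n + 1) := pow_le_pow_right₀ hR1 (by omega)
            linarith [h1.1, h1.2]
        · rfl
    all_goals tauto
  have hnorm := hT.norm_le hLp (by positivity) hker
  calc r * ‖T‖ ≤ r * ∑ n ∈ I, JD L f / R ^ (2 * n - 1) * √D := by gcongr
    _ = √D * (∑ n ∈ I, r / R ^ (2 * n - 1)) * JD L f := by
        rw [Finset.mul_sum, Finset.mul_sum, Finset.sum_mul]
        exact Finset.sum_congr rfl fun n _ => by ring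
    _ ≤ √D * (4 * R ^ 2) * JD L f := by
        gcongr
        exact sum_div_pow_le (by linarith) I hI1
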